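/- Let ℓ̄ be the multiplicity of f in the minimal polynomial of A, let B be a Jordan–Krylov basis of ker f(A)^ℓ̄ with respect to A, and let α ∈ ℂ be a root of f. Then the family of subspaces {P_A(α,b) : b ∈ B} of ℂ^n is independent, and Σ_{b∈B} P_A(α,b) equals the generalized eigenspace of A associated with the eigenvalue α, namely {v ∈ ℂ^n : (A − αI)^n v = 0}. -/

import Mathlib

open Polynomial Matrix
set_option synthInstance.maxHeartbeats 1000000
set_option maxHeartbeats 1000000

/-- The complex matrix obtained from a matrix over a subfield `K` of `ℂ`. -/
noncomputable def matC (K : Subfield ℂ) {n : ℕ} (A : Matrix (Fin n) (Fin n) K) :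
    Matrix (Fin n) (Fin n) ℂ :=
  A.map (fun x => (x : ℂ))

/-- The complex vector obtained from a vector over a subfield `K` of `ℂ`. -/
noncomputable def vecC (K : Subfield ℂ) {n : ℕ} (w : Fin n → K) : Fin n → ℂ :=
  fun i => (w i : ℂ)

/-- For a root `α` of `f`, the quotient `g_α(x) = f(x)/(x - α)` in `ℂ[x]`,
i.e. the paper's `ψ_f(x, α)`. -/
noncomputable def galpha (K : Subfield ℂ) (f : Polynomial K) (α : ℂ) : Polynomial ℂ :=
  (f.map K.subtype) / (X - C α)

/-- The generalized eigenvector `p⁽ᵏ⁾(α, u) = g_α(A)^k · f(A)^(ℓ-k) · u`, where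
`ℓ = rank_f u`. -/
noncomputable def pvec (K : Subfield ℂ) {n : ℕ} (A : Matrix (Fin n) (Fin n) K)
    (f : Polynomial K) (α : ℂ) (ℓ k : ℕ) (u : Fin n → K) : Fin n → ℂ :=
  ((Polynomial.aeval (matC K A) (galpha K f α)) ^ k *
    (Polynomial.aeval (matC K A) (f.map K.subtype)) ^ (ℓ - k)).mulVec (vecC K u)

/-- `rank_f u`: the least `ℓ` with `f(A)^ℓ u = 0`. -/
noncomputable def rankf (K : Subfield ℂ) {n : ℕ} (A : Matrix (Fin n) (Fin n) K)
    (f : Polynomial K) (u : Fin n → K) : ℕ :=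
  sInf {ℓ : ℕ | ((Polynomial.aeval A f) ^ ℓ).mulVec u = 0}

/-- The subspace `P_A(α, u) = Span_ℂ {p⁽ᵏ⁾(α, u) : 1 ≤ k ≤ rank_f u}` of `ℂ^n`. -/
noncomputable def Pspace (K : Subfield ℂ) {n : ℕ} (A : Matrix (Fin n) (Fin n) K)
    (f : Polynomial K) (α : ℂ) (u : Fin n → K) : Submodule ℂ (Fin n → ℂ) :=
  Submodule.span ℂ
    ((fun k => pvec K A f α (rankf K A f u) k u) '' Set.Icc 1 (rankf K A f u))

/-- The Krylov subspace `L_A(u) = Span_K {A^k u : k ≥ 0}`. -/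
noncomputable def krylov (K : Subfield ℂ) {n : ℕ} (A : Matrix (Fin n) (Fin n) K)
    (u : Fin n → K) : Submodule K (Fin n → K) :=
  Submodule.span K (Set.range fun k : ℕ => (A ^ k).mulVec u)

/-- `B` is a Jordan–Krylov basis of `ker f(A)^ℓ̄` with respect to `A`:
it is a finite subset of `ker f(A)^ℓ̄`, the family of Krylov subspaces of its elements
is independent, and their sum is `ker f(A)^ℓ̄`. -/
def IsJordanKrylovBasis (K : Subfield ℂ) {n : ℕ} (A : Matrix (Fin n) (Fin n) K)
    (f : Polynomial K) (lbar : ℕ) (B : Finset (Fin n → K)) : Prop :=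
  (∀ b ∈ B, ((Polynomial.aeval A f) ^ lbar).mulVec b = 0) ∧
  iSupIndep (fun b : B => krylov K A b.val) ∧
  (⨆ b ∈ B, krylov K A b) = LinearMap.ker (((Polynomial.aeval A f) ^ lbar).mulVecLin)

/-- The map `vecC` as a `K`-linear map. -/
noncomputable def vecCLin (K : Subfield ℂ) (n : ℕ) : (Fin n → K) →ₗ[K] (Fin n → ℂ) where
  toFun := vecC K
  map_add' _ _ := by ext; simp [vecC]
  map_smul' c v := by ext; simp [vecC, Subfield.smul_def]

theorem vecC_zero (K : Subfield ℂ) (n : ℕ) : vecC K (0 : Fin n → K) = 0 :=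
  (vecCLin K n).map_zero

/-- The complex span of a `K`-subspace of `K^n`. -/
noncomputable def complexSpan (K : Subfield ℂ) {n : ℕ} (V : Submodule K (Fin n → K)) :
    Submodule ℂ (Fin n → ℂ) :=
  Submodule.span ℂ (vecC K '' V)

section ComplexSpan

variable {K : Subfield ℂ} {n : ℕ}

theorem vecC_mem_complexSpan {V : Submodule K (Fin n → K)} {v : Fin n → K} (hv : v ∈ V) :
    vecC K v ∈ complexSpan K V :=
  Submodule.subset_span ⟨v, hv, rfl⟩

theorem complexSpan_mono {V W : Submodule K (Fin n → K)} (h : V ≤ W) :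
    complexSpan K V ≤ complexSpan K W :=
  Submodule.span_mono (Set.image_mono h)

theorem complexSpan_le_iff {V : Submodule K (Fin n → K)} {W : Submodule ℂ (Fin n → ℂ)} :
    complexSpan K V ≤ W ↔ V ≤ (W.restrictScalars K).comap (vecCLin K n) := by
  rw [complexSpan, Submodule.span_le, Set.image_subset_iff]
  rfl

theorem complexSpan_iSup {ι : Sort*} (V : ι → Submodule K (Fin n → K)) :
    complexSpan K (⨆ i, V i) = ⨆ i, complexSpan K (V i) := by
  refine le_antisymm ?_ (iSup_le fun i => complexSpan_mono (le_iSup V i))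
  rw [complexSpan_le_iff]
  exact iSup_le fun i => complexSpan_le_iff.1 (le_iSup (fun i => complexSpan K (V i)) i)

/-- Applying a `K`-linear functional of `ℂ` coordinatewise maps the complex span of `V` into `V`. -/
theorem comp_mem_of_mem_complexSpan (φ : ℂ →ₗ[K] K) {V : Submodule K (Fin n → K)}
    {x : Fin n → ℂ} (hx : x ∈ complexSpan K V) : (fun i => φ (x i)) ∈ V := by
  rw [complexSpan] at hx
  induction hx using Submodule.closure_induction with
  | zero =>
    simp only [Pi.zero_apply, map_zero]
    exact V.zero_mem
  | add x y _ _ hx hy =>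
    simp only [Pi.add_apply, map_add]
    exact V.add_mem hx hy
  | smul_mem c x hx =>
    obtain ⟨v, hv, rfl⟩ := hx
    have : (fun i => φ ((c • vecC K v) i)) = φ c • v := by
      ext1 i
      have : (c • vecC K v) i = v i • c := by simp [vecC, Subfield.smul_def, mul_comm]
      rw [this, map_smul, Pi.smul_apply, smul_eq_mul, smul_eq_mul, mul_comm]
    rw [this]
    exact V.smul_mem _ hv

theorem disjoint_complexSpan {V W : Submodule K (Fin n → K)} (h : Disjoint V W) :
    Disjoint (complexSpan K V) (complexSpan K W) := by
  rw [Submodule.disjoint_def] at h ⊢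
  intro x hV hW
  ext i
  refine (Module.forall_dual_apply_eq_zero_iff K (x i)).1 fun φ => ?_
  exact congrFun (h _ (comp_mem_of_mem_complexSpan φ hV) (comp_mem_of_mem_complexSpan φ hW)) i

theorem iSupIndep_complexSpan {ι : Type*} {V : ι → Submodule K (Fin n → K)} (h : iSupIndep V) :
    iSupIndep fun i => complexSpan K (V i) := by
  intro i
  simpa only [complexSpan_iSup] using disjoint_complexSpan (h i)

end ComplexSpan

section Krylov

variable {K : Subfield ℂ} {n : ℕ} {A : Matrix (Fin n) (Fin n) K} {f : Polynomial K} {α : ℂ}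

theorem matC_mulVec_vecC (A : Matrix (Fin n) (Fin n) K) (u : Fin n → K) :
    (matC K A).mulVec (vecC K u) = vecC K (A.mulVec u) := by
  ext i
  simp [matC, vecC, Matrix.mulVec, dotProduct]

theorem matC_eq_mapMatrix (A : Matrix (Fin n) (Fin n) K) :
    matC K A = (Algebra.ofId K ℂ).mapMatrix A :=
  rfl

theorem matC_pow (A : Matrix (Fin n) (Fin n) K) (k : ℕ) : matC K (A ^ k) = matC K A ^ k :=
  map_pow (Algebra.ofId K ℂ).mapMatrix A k

theorem aeval_matC_map (A : Matrix (Fin n) (Fin n) K) (p : K[X]) :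
    aeval (matC K A) (p.map K.subtype) = matC K (aeval A p) := by
  rw [matC_eq_mapMatrix, matC_eq_mapMatrix, ← aeval_algHom_apply]
  exact aeval_map_algebraMap ℂ _ p

theorem aeval_mulVec_vecC_mem (A : Matrix (Fin n) (Fin n) K) (u : Fin n → K) (p : ℂ[X]) :
    (aeval (matC K A) p).mulVec (vecC K u) ∈ complexSpan K (krylov K A u) := by
  induction p using Polynomial.induction_on' with
  | add p q hp hq =>
    rw [map_add, Matrix.add_mulVec]
    exact add_mem hp hq
  | monomial k c =>
    rw [aeval_monomial, ← Algebra.smul_def, Matrix.smul_mulVec, ← matC_pow, matC_mulVec_vecC]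
    exact Submodule.smul_mem _ _
      (vecC_mem_complexSpan (Submodule.subset_span ⟨k, rfl⟩))

theorem Pspace_le_complexSpan_krylov (u : Fin n → K) :
    Pspace K A f α u ≤ complexSpan K (krylov K A u) := by
  rw [Pspace, Submodule.span_le]
  rintro _ ⟨k, -, rfl⟩
  simp only [pvec, ← map_pow, ← map_mul]
  exact aeval_mulVec_vecC_mem A u _

theorem X_sub_C_mul_galpha (hα : (f.map K.subtype).IsRoot α) :
    (X - C α) * galpha K f α = f.map K.subtype :=
  mul_div_eq_iff_isRoot.2 hα

theorem isCoprime_X_sub_C_galpha (hirr : Irreducible f) (hα : (f.map K.subtype).IsRoot α) :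
    IsCoprime (X - C α) (galpha K f α) := by
  refine Separable.isCoprime ?_
  rw [X_sub_C_mul_galpha hα]
  exact hirr.separable.map

theorem aeval_pow_rankf_mulVec {l : ℕ} {u : Fin n → K}
    (hu : ((aeval A f) ^ l).mulVec u = 0) : ((aeval A f) ^ rankf K A f u).mulVec u = 0 :=
  Nat.sInf_mem (s := {l | ((aeval A f) ^ l).mulVec u = 0}) ⟨l, hu⟩

theorem aeval_X_sub_C_pow_mul_mem_Pspace (hα : (f.map K.subtype).IsRoot α) {u : Fin n → K}
    (hu : ((aeval A f) ^ rankf K A f u).mulVec u = 0) (j : ℕ) :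
    (aeval (matC K A) ((X - C α) ^ j * galpha K f α ^ rankf K A f u)).mulVec (vecC K u) ∈
      Pspace K A f α u := by
  by_cases hj : j < rankf K A f u
  · refine Submodule.subset_span ⟨rankf K A f u - j, ⟨by omega, by omega⟩, ?_⟩
    simp only [pvec, ← map_pow, ← map_mul]
    rw [← X_sub_C_mul_galpha hα, Nat.sub_sub_self hj.le, mul_pow, mul_left_comm, ← pow_add,
      Nat.sub_add_cancel hj.le]
  · obtain ⟨d, rfl⟩ := Nat.exists_eq_add_of_le (not_lt.1 hj)
    rw [pow_add, mul_right_comm, ← mul_pow, X_sub_C_mul_galpha hα, mul_comm, map_mul,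
      ← Matrix.mulVec_mulVec, ← Polynomial.map_pow, aeval_matC_map, matC_mulVec_vecC,
      map_pow (aeval A), hu, vecC_zero, Matrix.mulVec_zero]
    exact Submodule.zero_mem _

theorem aeval_mul_galpha_pow_mem_Pspace (hα : (f.map K.subtype).IsRoot α) {u : Fin n → K}
    (hu : ((aeval A f) ^ rankf K A f u).mulVec u = 0) (q : ℂ[X]) :
    (aeval (matC K A) (q * galpha K f α ^ rankf K A f u)).mulVec (vecC K u) ∈
      Pspace K A f α u := by
  rw [← sum_taylor_eq q α, Polynomial.sum_def, Finset.sum_mul, map_sum, Matrix.sum_mulVec]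
  refine Submodule.sum_mem _ fun j _ => ?_
  rw [mul_assoc, map_mul, aeval_C, ← Algebra.smul_def, Matrix.smul_mulVec]
  exact Submodule.smul_mem _ _ (aeval_X_sub_C_pow_mul_mem_Pspace hα hu j)

theorem aeval_X_sub_C_pow_mulVec_eq_zero (hα : (f.map K.subtype).IsRoot α) {u : Fin n → K}
    (hu : ((aeval A f) ^ rankf K A f u).mulVec u = 0) {x : Fin n → ℂ}
    (hx : x ∈ Pspace K A f α u) :
    (aeval (matC K A) ((X - C α) ^ rankf K A f u)).mulVec x = 0 := by
  suffices Pspace K A f α u ≤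
      LinearMap.ker (aeval (matC K A) ((X - C α) ^ rankf K A f u)).mulVecLin from this hx
  rw [Pspace, Submodule.span_le]
  rintro _ ⟨k, ⟨-, hk⟩, rfl⟩
  have : (X - C α) ^ rankf K A f u * (galpha K f α ^ k * (f.map K.subtype) ^ (rankf K A f u - k)) =
      (X - C α) ^ (rankf K A f u - k) * (f ^ rankf K A f u).map K.subtype := by
    obtain ⟨d, hd⟩ := Nat.exists_eq_add_of_le hk
    rw [Polynomial.map_pow, hd, Nat.add_sub_cancel_left, ← X_sub_C_mul_galpha hα]
    generalize X - C α = q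
    ring
  simp only [SetLike.mem_coe, LinearMap.mem_ker, Matrix.mulVecLin_apply, pvec, ← map_pow, ← map_mul,
    Matrix.mulVec_mulVec]
  rw [this, map_mul, ← Matrix.mulVec_mulVec, aeval_matC_map, matC_mulVec_vecC,
    map_pow (aeval A), hu, vecC_zero, Matrix.mulVec_zero]

/-- If `f ^ l` and `h` are coprime and `f ^ l * h` annihilates `A`, then the complex kernel of
`f(A) ^ l` is contained in the complex span of its kernel over `K`. -/
theorem mem_complexSpan_ker {l : ℕ} {h : K[X]} (hcop : IsCoprime (f ^ l) h)
    (hA : aeval A (f ^ l * h) = 0) {v : Fin n → ℂ}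
    (hv : (aeval (matC K A) ((f ^ l).map K.subtype)).mulVec v = 0) :
    v ∈ complexSpan K (LinearMap.ker ((aeval A f ^ l).mulVecLin)) := by
  obtain ⟨a, c, hac⟩ := hcop
  have key : (aeval (matC K A) ((c * h).map K.subtype)).mulVec v = v := by
    have := congrArg (fun p : K[X] => (aeval (matC K A) (p.map K.subtype)).mulVec v) hac
    simpa [Matrix.add_mulVec, ← Matrix.mulVec_mulVec, show
      (aeval (matC K A) (f.map K.subtype) ^ l).mulVec v = 0 by simpa using hv] using this
  rw [← key, aeval_matC_map]
  have hsum : (matC K (aeval A (c * h))).mulVec v =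
      ∑ j, v j • vecC K ((aeval A (c * h)).mulVec (Pi.single j 1)) := by
    ext i
    simp [Matrix.mulVec, dotProduct, matC, vecC, mul_comm]
  rw [hsum]
  refine Submodule.sum_mem _ fun j _ => Submodule.smul_mem _ _ (vecC_mem_complexSpan ?_)
  rw [LinearMap.mem_ker, Matrix.mulVecLin_apply, Matrix.mulVec_mulVec, ← map_pow, ← map_mul,
    mul_left_comm, map_mul, hA, mul_zero, Matrix.zero_mulVec]

theorem isCoprime_X_sub_C_map {h : K[X]} (hα : (f.map K.subtype).IsRoot α) (hcop : IsCoprime f h) :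
    IsCoprime (X - C α) (h.map K.subtype) :=
  (hcop.map (mapRingHom K.subtype)).of_isCoprime_of_dvd_left (dvd_iff_isRoot.2 hα)

theorem aeval_pow_mulVec_eq_zero_of_mem_genEigenspace
    (hα : (f.map K.subtype).IsRoot α) {l m : ℕ} {h : K[X]} (hcop : IsCoprime f h)
    (hA : aeval A (f ^ l * h) = 0) {v : Fin n → ℂ}
    (hv : (aeval (matC K A) ((X - C α) ^ m)).mulVec v = 0) :
    (aeval (matC K A) ((f ^ l).map K.subtype)).mulVec v = 0 := by
  obtain ⟨s, t, hst⟩ : IsCoprime ((X - C α) ^ m) (h.map K.subtype) :=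
    (isCoprime_X_sub_C_map hα hcop).pow_left
  have hF : (f ^ l).map K.subtype =
      (f ^ l).map K.subtype * s * (X - C α) ^ m + t * (f ^ l * h).map K.subtype := by
    rw [Polynomial.map_mul]
    linear_combination (-(f ^ l).map K.subtype) * hst
  rw [hF, map_add, map_mul, map_mul _ t, aeval_matC_map, hA, Matrix.add_mulVec,
    ← Matrix.mulVec_mulVec, hv, show matC K (0 : Matrix (Fin n) (Fin n) K) = 0 from
      map_zero (Algebra.ofId K ℂ).mapMatrix, mul_zero, Matrix.mulVec_zero,
    Matrix.zero_mulVec, add_zero]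

end Krylov

theorem stmt7 (K : Subfield ℂ) (n : ℕ) (hn : 1 ≤ n)
    (A : Matrix (Fin n) (Fin n) K) (f : Polynomial K)
    (hmonic : f.Monic) (hirr : Irreducible f) (hdvd : f ∣ A.charpoly)
    (lbar : ℕ) (hl1 : f ^ lbar ∣ minpoly K A) (hl2 : ¬ f ^ (lbar + 1) ∣ minpoly K A)
    (B : Finset (Fin n → K)) (hB : IsJordanKrylovBasis K A f lbar B)
    (α : ℂ) (hα : (f.map K.subtype).IsRoot α) :
    iSupIndep (fun b : B => Pspace K A f α b.val) ∧
      (⨆ b ∈ B, Pspace K A f α b) =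
        LinearMap.ker
          (((matC K A - α • (1 : Matrix (Fin n) (Fin n) ℂ)) ^ n).mulVecLin) := by
  obtain ⟨hker, hind, hsup⟩ := hB
  have hrank : ∀ b ∈ B, ((aeval A f) ^ rankf K A f b).mulVec b = 0 := fun b hb =>
    aeval_pow_rankf_mulVec (hker b hb)
  have hN : ∀ m : ℕ, (matC K A - α • (1 : Matrix (Fin n) (Fin n) ℂ)) ^ m =
      aeval (matC K A) ((X - C α) ^ m) := fun m => by
    rw [map_pow, map_sub, aeval_X, aeval_C, Algebra.algebraMap_eq_smul_one]
  refine ⟨(iSupIndep_complexSpan hind).mono fun b => Pspace_le_complexSpan_krylov b.val,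
    le_antisymm (iSup₂_le fun b hb x hx => ?_) fun v hv => ?_⟩
  · have hx0 := aeval_X_sub_C_pow_mulVec_eq_zero hα (hrank b hb) hx
    rw [← hN] at hx0
    have h1 : x ∈ LinearMap.ker
        ((Matrix.toLin' (matC K A - α • (1 : Matrix (Fin n) (Fin n) ℂ))) ^ rankf K A f b) := by
      rw [← Matrix.toLin'_pow]
      exact hx0
    have h2 := Module.End.ker_pow_le_ker_pow_finrank _ _ h1
    rw [Module.finrank_fin_fun, ← Matrix.toLin'_pow] at h2
    exact h2
  · rw [LinearMap.mem_ker, Matrix.mulVecLin_apply, hN] at hv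
    obtain ⟨h, hh⟩ := hl1
    have hfh : IsCoprime f h := hirr.coprime_iff_not_dvd.2 fun hd => hl2 <| by
      rw [hh, pow_succ]
      exact mul_dvd_mul_left _ hd
    have hA : aeval A (f ^ lbar * h) = 0 := by rw [← hh, minpoly.aeval]
    have hmem := mem_complexSpan_ker hfh.pow_left hA
      (aeval_pow_mulVec_eq_zero_of_mem_genEigenspace hα hfh hA hv)
    rw [← hsup] at hmem
    simp only [complexSpan_iSup] at hmem
    obtain ⟨s, t, hst⟩ : IsCoprime ((X - C α) ^ n) (galpha K f α ^ lbar) :=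
      (isCoprime_X_sub_C_galpha hirr hα).pow
    have hE : (aeval (matC K A) (t * galpha K f α ^ lbar)).mulVec v = v := by
      have := congrArg (fun p : ℂ[X] => (aeval (matC K A) p).mulVec v) hst
      simp only [map_add, map_one, Matrix.add_mulVec, Matrix.one_mulVec] at this
      rwa [map_mul _ s, ← Matrix.mulVec_mulVec, hv, Matrix.mulVec_zero, zero_add] at this
    suffices (⨆ b ∈ B, complexSpan K (krylov K A b)) ≤ (⨆ b ∈ B, Pspace K A f α b).comap
        (aeval (matC K A) (t * galpha K f α ^ lbar)).mulVecLin by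
      have := this hmem
      rwa [Submodule.mem_comap, Matrix.mulVecLin_apply, hE] at this
    refine iSup₂_le fun b hb => ?_
    rw [complexSpan_le_iff, krylov, Submodule.span_le]
    rintro _ ⟨k, rfl⟩
    refine (le_iSup₂ (f := fun b (_ : b ∈ B) => Pspace K A f α b) b hb) ?_
    have hle : rankf K A f b ≤ lbar := Nat.sInf_le (hker b hb)
    have hk : vecC K ((A ^ k).mulVec b) = (aeval (matC K A) (X ^ k : ℂ[X])).mulVec (vecC K b) := by
      rw [← matC_mulVec_vecC, matC_pow, map_pow, aeval_X]
    have hmul : t * galpha K f α ^ lbar * X ^ k =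
        t * X ^ k * galpha K f α ^ (lbar - rankf K A f b) * galpha K f α ^ rankf K A f b := by
      rw [mul_assoc (t * X ^ k), ← pow_add, Nat.sub_add_cancel hle, mul_right_comm]
    have := aeval_mul_galpha_pow_mem_Pspace hα (hrank b hb)
      (t * X ^ k * galpha K f α ^ (lbar - rankf K A f b))
    rw [← hmul, map_mul, ← Matrix.mulVec_mulVec, ← hk] at this
    exact this
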